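/- Let P be the Pell sequence (P_0 = 0, P_1 = 1, P_n = 2P_{n-1} + P_{n-2}), Q the associated Pell sequence (Q_0 = 1, Q_1 = 1, Q_n = 2Q_{n-1} + Q_{n-2}), and b the cobalancing sequence (b_0 = 0, b_1 = 0, b_n = 6b_{n-1} − b_{n-2} + 2). For every k ≥ 1, the greatest common divisor of the set { Σ_{i=1}^{k} b_{n+i} : n ≥ 0 } of all sums of k consecutive cobalancing numbers equals gcd(P_k, k) if k is even, and equals 2·gcd(Q_k, k) if k is odd. -/

import Mathlib

/-- The Pell sequence: P₀ = 0, P₁ = 1, Pₙ = 2Pₙ₋₁ + Pₙ₋₂. -/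
def pell : ℕ → ℤ
  | 0 => 0
  | 1 => 1
  | n + 2 => 2 * pell (n + 1) + pell n

/-- The associated Pell sequence: Q₀ = 1, Q₁ = 1, Qₙ = 2Qₙ₋₁ + Qₙ₋₂. -/
def assocPell : ℕ → ℤ
  | 0 => 1
  | 1 => 1
  | n + 2 => 2 * assocPell (n + 1) + assocPell n

/-- The cobalancing sequence: b₀ = 0, b₁ = 0, bₙ = 6bₙ₋₁ − bₙ₋₂ + 2. -/
def cobalancing : ℕ → ℤ
  | 0 => 0
  | 1 => 0
  | n + 2 => 6 * cobalancing (n + 1) - cobalancing n + 2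

/-- `d` is the greatest common divisor of the set `{S n : n ≥ 0}`: `d ≥ 0`, `d` divides
every element of the set, and every common divisor of the set divides `d`. -/
def IsSetGCD (S : ℕ → ℤ) (d : ℤ) : Prop :=
  0 ≤ d ∧ (∀ n : ℕ, d ∣ S n) ∧ ∀ e : ℤ, (∀ n : ℕ, e ∣ S n) → e ∣ d

theorem pell_assocPell_succ (n : ℕ) :
    pell (n + 1) = pell n + assocPell n ∧ assocPell (n + 1) = assocPell n + 2 * pell n := by
  induction n with
  | zero => simp [pell, assocPell]
  | succ n ih =>
    obtain ⟨h₁, h₂⟩ := ih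
    refine ⟨?_, ?_⟩
    · rw [pell]; linarith
    · rw [assocPell]; linarith

theorem pell_succ (n : ℕ) : pell (n + 1) = pell n + assocPell n :=
  (pell_assocPell_succ n).1

theorem assocPell_succ (n : ℕ) : assocPell (n + 1) = assocPell n + 2 * pell n :=
  (pell_assocPell_succ n).2

theorem pell_assocPell_add (m k : ℕ) :
    pell (m + k) = pell m * assocPell k + assocPell m * pell k ∧
      assocPell (m + k) = assocPell m * assocPell k + 2 * pell m * pell k := by
  induction k with
  | zero => simp [pell, assocPell]
  | succ k ih =>
    obtain ⟨h₁, h₂⟩ := ih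
    rw [← add_assoc, pell_succ, assocPell_succ, pell_succ, assocPell_succ, h₁, h₂]
    constructor <;> ring

theorem assocPell_sq_sub (n : ℕ) : assocPell n ^ 2 - 2 * pell n ^ 2 = (-1) ^ n := by
  induction n with
  | zero => simp [pell, assocPell]
  | succ n ih =>
    rw [pell_succ, assocPell_succ, pow_succ (-1), ← ih]
    ring

theorem assocPell_sq_sub_sq (n : ℕ) : (assocPell n ^ 2 - 2 * pell n ^ 2) ^ 2 = 1 := by
  rw [assocPell_sq_sub, ← pow_mul, mul_comm, pow_mul]
  norm_num

theorem odd_assocPell (n : ℕ) : Odd (assocPell n) := by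
  induction n with
  | zero => simp [assocPell]
  | succ n ih => rw [assocPell_succ]; exact ih.add_even (even_two_mul _)

theorem odd_pell {n : ℕ} (hn : Odd n) : Odd (pell n) := by
  obtain ⟨j, rfl⟩ := hn
  rw [pell_succ, two_mul, (pell_assocPell_add j j).1]
  refine Even.add_odd ⟨pell j * assocPell j, by ring⟩ (odd_assocPell _)

theorem pell_add_two_mul_sub (m k : ℕ) :
    pell (m + 2 * k) - (-1) ^ k * pell m = 2 * pell k * assocPell (m + k) := by
  rw [two_mul, ← add_assoc, (pell_assocPell_add (m + k) k).1, ← assocPell_sq_sub,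
    (pell_assocPell_add m k).1, (pell_assocPell_add m k).2]
  ring

theorem pell_add_two_mul_add (m k : ℕ) :
    pell (m + 2 * k) + (-1) ^ k * pell m = 2 * assocPell k * pell (m + k) := by
  rw [two_mul, ← add_assoc, (pell_assocPell_add (m + k) k).1, ← assocPell_sq_sub,
    (pell_assocPell_add m k).1, (pell_assocPell_add m k).2]
  ring

theorem two_mul_cobalancing_succ (n : ℕ) : 2 * cobalancing (n + 1) + 1 = pell (2 * n + 1) := by
  induction n using Nat.twoStepInduction with
  | zero => simp [pell, cobalancing]
  | one => simp [pell, cobalancing]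
  | more n h₁ h₂ =>
    have e₁ : 2 * (n + 1) + 1 = 2 * n + 1 + 1 + 1 := by ring
    have e₂ : 2 * (n + 2) + 1 = 2 * n + 1 + 1 + 1 + 1 + 1 := by ring
    rw [cobalancing]
    simp only [e₁, e₂, pell_succ, assocPell_succ] at *
    linarith

theorem even_cobalancing (n : ℕ) : 2 ∣ cobalancing n := by
  induction n using Nat.twoStepInduction with
  | zero => simp [cobalancing]
  | one => simp [cobalancing]
  | more n h₁ h₂ => rw [cobalancing]; omega

theorem four_mul_sum_cobalancing (n k : ℕ) :
    4 * ∑ i ∈ Finset.Icc 1 k, cobalancing (n + i) + 2 * k = pell (2 * n + 2 * k) - pell (2 * n) := by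
  induction k with
  | zero => simp
  | succ k ih =>
    have h := two_mul_cobalancing_succ (n + k)
    have e : 2 * n + 2 * (k + 1) = 2 * (n + k) + 1 + 1 := by ring
    have e' : 2 * n + 2 * k = 2 * (n + k) := by ring
    rw [Finset.sum_Icc_succ_top (by omega), e, pell, ← add_assoc n k 1]
    rw [e'] at ih
    push_cast
    linarith

theorem two_mul_sum_cobalancing_of_even {k : ℕ} (hk : Even k) (n : ℕ) :
    2 * ∑ i ∈ Finset.Icc 1 k, cobalancing (n + i) + k = pell k * assocPell (2 * n + k) := by
  have h := pell_add_two_mul_sub (2 * n) k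
  rw [hk.neg_one_pow] at h
  linarith [four_mul_sum_cobalancing n k]

theorem two_mul_sum_cobalancing_of_odd {k : ℕ} (hk : Odd k) (n : ℕ) :
    2 * ∑ i ∈ Finset.Icc 1 k, cobalancing (n + i) + k = assocPell k * pell (2 * n + k) := by
  have h := pell_add_two_mul_add (2 * n) k
  rw [hk.neg_one_pow] at h
  linarith [four_mul_sum_cobalancing n k]

/-- `pell k` and `k` have the same 2-adic valuation. -/
theorem exists_odd_mul_pell_eq (k : ℕ) :
    ∃ u t : ℤ, Odd u ∧ Odd t ∧ u * pell k = t * k := by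
  induction k using Nat.strong_induction_on with
  | _ k ih =>
    rcases Nat.even_or_odd k with ⟨j, rfl⟩ | hk
    · rcases Nat.eq_zero_or_pos j with rfl | hj
      · exact ⟨1, 1, odd_one, odd_one, by simp [pell]⟩
      · obtain ⟨u, t, hu, ht, h⟩ := ih j (by omega)
        refine ⟨u, t * assocPell j, hu, ht.mul (odd_assocPell j), ?_⟩
        rw [(pell_assocPell_add j j).1]
        push_cast
        linear_combination 2 * assocPell j * h
    · exact ⟨k, pell k, by exact_mod_cast hk, odd_pell hk, mul_comm _ _⟩

theorem dvd_of_dvd_mul_assocPell {e a : ℤ} {m : ℕ} (h₁ : e ∣ a * assocPell m)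
    (h₂ : e ∣ a * assocPell (m + 2)) : e ∣ a := by
  rw [assocPell_succ, assocPell_succ, pell_succ] at h₂
  obtain ⟨x, hx⟩ := h₁
  obtain ⟨y, hy⟩ := h₂
  have h := assocPell_sq_sub_sq m
  refine ⟨x * (assocPell m ^ 3 - 4 * assocPell m * pell m ^ 2) + (y - 3 * x) * pell m ^ 3, ?_⟩
  linear_combination -a * h + (assocPell m ^ 3 - 4 * assocPell m * pell m ^ 2) * hx
    + pell m ^ 3 * (hy - 3 * hx)

theorem dvd_two_mul_of_dvd_mul_pell {e a : ℤ} {m : ℕ} (h₁ : e ∣ a * pell m)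
    (h₂ : e ∣ a * pell (m + 2)) : e ∣ 2 * a := by
  rw [pell_succ, pell_succ, assocPell_succ] at h₂
  obtain ⟨x, hx⟩ := h₁
  obtain ⟨y, hy⟩ := h₂
  have h := assocPell_sq_sub_sq m
  refine ⟨x * (8 * pell m ^ 3 - 8 * assocPell m ^ 2 * pell m) + (y - 3 * x) * assocPell m ^ 3, ?_⟩
  linear_combination -2 * a * h + (8 * pell m ^ 3 - 8 * assocPell m ^ 2 * pell m) * hx
    + assocPell m ^ 3 * (hy - 3 * hx)

theorem sum_cobalancing_sub_of_even {k : ℕ} (hk : Even k) (n : ℕ) :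
    ∑ i ∈ Finset.Icc 1 k, cobalancing (n + 1 + i) - ∑ i ∈ Finset.Icc 1 k, cobalancing (n + i) =
      pell k * assocPell (2 * n + k + 1) := by
  have h₀ := two_mul_sum_cobalancing_of_even hk n
  have h₁ := two_mul_sum_cobalancing_of_even hk (n + 1)
  rw [show 2 * (n + 1) + k = 2 * n + k + 2 by ring, assocPell] at h₁
  linarith

theorem sum_cobalancing_sub_of_odd {k : ℕ} (hk : Odd k) (n : ℕ) :
    ∑ i ∈ Finset.Icc 1 k, cobalancing (n + 1 + i) - ∑ i ∈ Finset.Icc 1 k, cobalancing (n + i) =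
      assocPell k * pell (2 * n + k + 1) := by
  have h₀ := two_mul_sum_cobalancing_of_odd hk n
  have h₁ := two_mul_sum_cobalancing_of_odd hk (n + 1)
  rw [show 2 * (n + 1) + k = 2 * n + k + 2 by ring, pell] at h₁
  linarith

theorem gcd_pell_dvd_sum_cobalancing {k : ℕ} (hk : 1 ≤ k) (hk' : Even k) (n : ℕ) :
    (Int.gcd (pell k) k : ℤ) ∣ ∑ i ∈ Finset.Icc 1 k, cobalancing (n + i) := by
  have hd : 0 < Int.gcd (pell k) k := Int.gcd_pos_of_ne_zero_right _ (by omega)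
  obtain ⟨p, q, hpq, hp, hq⟩ := Int.exists_gcd_one hd
  set d : ℤ := (Int.gcd (pell k) k : ℤ)
  have hd0 : d ≠ 0 := by positivity
  obtain ⟨u, t, hu, ht, h⟩ := exists_odd_mul_pell_eq k
  have hut : u * p = t * q := by
    rw [hp, hq] at h
    exact mul_right_cancel₀ hd0 (by linear_combination h)
  have hiff : Odd p ↔ Odd q := by
    have := congrArg Odd hut
    simpa [Int.odd_mul, hu, ht] using this
  have hodd : Odd p ∧ Odd q := by
    rw [← hiff, and_self]
    by_contra hne
    have hp2 := (Int.not_odd_iff_even.1 hne).two_dvd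
    have hq2 := (Int.not_odd_iff_even.1 (mt hiff.2 hne)).two_dvd
    have := Int.dvd_coe_gcd hp2 hq2
    rw [hpq] at this
    norm_num at this
  obtain ⟨c, hc⟩ := (hodd.1.mul (odd_assocPell (2 * n + k))).sub_odd hodd.2
  refine ⟨c, ?_⟩
  have hS := two_mul_sum_cobalancing_of_even hk' n
  have hS' : 2 * ∑ i ∈ Finset.Icc 1 k, cobalancing (n + i) = 2 * (d * c) := by
    linear_combination hS + assocPell (2 * n + k) * hp - hq + d * hc
  linarith

theorem two_mul_gcd_assocPell_dvd_sum_cobalancing {k : ℕ} (hk : Odd k) (n : ℕ) :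
    2 * (Int.gcd (assocPell k) k : ℤ) ∣ ∑ i ∈ Finset.Icc 1 k, cobalancing (n + i) := by
  have hodd : Odd (Int.gcd (assocPell k) k : ℤ) := by
    obtain ⟨c, hc⟩ := Int.gcd_dvd_left (assocPell k) k
    exact (Int.odd_mul.1 (hc ▸ odd_assocPell k)).1
  have hcop : IsCoprime (2 : ℤ) (Int.gcd (assocPell k) k : ℤ) :=
    Int.isCoprime_two_left.2 hodd
  refine hcop.mul_dvd (Finset.dvd_sum fun i _ => even_cobalancing _) ?_
  refine hcop.symm.dvd_of_dvd_mul_left ?_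
  rw [eq_sub_of_add_eq (two_mul_sum_cobalancing_of_odd hk n)]
  exact dvd_sub ((Int.gcd_dvd_left ..).mul_right _) (Int.gcd_dvd_right ..)

theorem gcd_sums_cobalancing (k : ℕ) (hk : 1 ≤ k) :
    (Even k →
      IsSetGCD (fun n => ∑ i ∈ Finset.Icc 1 k, cobalancing (n + i))
        (Int.gcd (pell k) (k : ℤ))) ∧
    (Odd k →
      IsSetGCD (fun n => ∑ i ∈ Finset.Icc 1 k, cobalancing (n + i))
        (2 * Int.gcd (assocPell k) (k : ℤ))) := by
  refine ⟨fun hk' => ⟨by positivity, gcd_pell_dvd_sum_cobalancing hk hk', fun e he => ?_⟩,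
    fun hk' => ⟨by positivity, two_mul_gcd_assocPell_dvd_sum_cobalancing hk', fun e he => ?_⟩⟩
  · have hdiff (n : ℕ) : e ∣ pell k * assocPell (2 * n + k + 1) := by
      rw [← sum_cobalancing_sub_of_even hk']
      exact dvd_sub (he (n + 1)) (he n)
    have hP : e ∣ pell k :=
      dvd_of_dvd_mul_assocPell (hdiff 0) (by convert hdiff 1 using 3; ring)
    refine Int.dvd_coe_gcd hP ?_
    rw [eq_sub_of_add_eq' (two_mul_sum_cobalancing_of_even hk' 0)]
    exact dvd_sub (hP.mul_right _) ((he 0).mul_left 2)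
  · have hdiff (n : ℕ) : e ∣ assocPell k * pell (2 * n + k + 1) := by
      rw [← sum_cobalancing_sub_of_odd hk']
      exact dvd_sub (he (n + 1)) (he n)
    have hQ : e ∣ 2 * assocPell k :=
      dvd_two_mul_of_dvd_mul_pell (hdiff 0) (by convert hdiff 1 using 3; ring)
    have hk2 : e ∣ 2 * (k : ℤ) := by
      rw [eq_sub_of_add_eq' (two_mul_sum_cobalancing_of_odd hk' 0), mul_sub, ← mul_assoc]
      exact dvd_sub (hQ.mul_right _) (((he 0).mul_left 2).mul_left 2)
    have h := Int.dvd_coe_gcd hQ hk2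
    rwa [Int.gcd_mul_left, Nat.cast_mul] at h
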